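/- arXiv:2411.08151 — 2 statements merged into one kernel-verified Lean document; each statement's English description precedes it below -/
import Mathlib

section
/- Let n be a power of 4, let α ≥ 1 be a real, and let G_{n,α} with critical path collection P be the grid construction defined in the context. Then: (a) |P| = Θ(n), and every critical path contains exactly one vertex in each layer L_i for i ∈ {1,…,√n/2}; (b) every critical path π ∈ P is the unique α-approximate shortest path between its endpoints, i.e. every other directed path between the same endpoints has total weight greater than α times the weight of π; (c) for every k ≥ 1, any k distinct critical paths in P have at most 2√n/k common vertices. -/
open Finset

/-- A walk in a directed edge set `F`, given as the list of visited vertices. -/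
def IsWalkOn {V : Type} (F : Finset (V × V)) (s t : V) (l : List V) : Prop :=
  l.Chain' (fun a b => (a, b) ∈ F) ∧ l.head? = some s ∧ l.getLast? = some t

def ReachableOn {V : Type} (F : Finset (V × V)) (s t : V) : Prop :=
  ∃ l, IsWalkOn F s t l

/-- A directed weighted graph: a finite set of directed edges together with weights. -/
structure WDigraph (V : Type) where
  Edge : Finset (V × V)
  w : V × V → ℝ

namespace WDigraph

variable {V : Type}

/-- Total weight of a walk (sum of weights of consecutive pairs). -/
def walkWeight (G : WDigraph V) (l : List V) : ℝ :=
  ((l.zip l.tail).map G.w).sum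

/-- Distance from `s` to `t` using only edges of `F`, with weights of `G`. -/
noncomputable def distOn (G : WDigraph V) (F : Finset (V × V)) (s t : V) : ℝ :=
  sInf {x | ∃ l, IsWalkOn F s t l ∧ G.walkWeight l = x}

def IsWalk (G : WDigraph V) (s t : V) (l : List V) : Prop :=
  IsWalkOn G.Edge s t l

def Reachable (G : WDigraph V) (s t : V) : Prop :=
  ReachableOn G.Edge s t

noncomputable def dist (G : WDigraph V) (s t : V) : ℝ :=
  G.distOn G.Edge s t

/-- All edge weights equal to `1`. -/
def Unweighted (G : WDigraph V) : Prop := ∀ e ∈ G.Edge, G.w e = 1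

/-- All edge weights positive. -/
def PosWeights (G : WDigraph V) : Prop := ∀ e ∈ G.Edge, 0 < G.w e

/-- `F` is (the edge set of) an exact distance preserver of `(G, P)`. -/
def IsExactPreserver (G : WDigraph V) (F : Finset (V × V)) (P : Finset (V × V)) : Prop :=
  F ⊆ G.Edge ∧ ∀ q ∈ P, ReachableOn F q.1 q.2 ∧ G.distOn F q.1 q.2 = G.dist q.1 q.2

/-- Total (in plus out) degree of a vertex. -/
def degree [DecidableEq V] (G : WDigraph V) (v : V) : ℕ :=
  (G.Edge.filter fun e => e.1 = v ∨ e.2 = v).card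

end WDigraph

/-- `bitRev m i`: the integer whose `m`-bit binary representation is the reversal of the
`m`-bit binary representation of `i`. -/
def bitRev (m i : ℕ) : ℕ := ∑ j ∈ Finset.range m, if Nat.testBit i j then 2 ^ (m - 1 - j) else 0

/-- The edges of the grid construction: horizontal edges `(x,y) → (x+1,y)` and diagonal
edges `(x,y) → (x+1,y+1)` between consecutive layers of the grid
`{0,…,√n/2−1} × {0,…,2√n−1}`. -/
def gridEdges (s : ℕ) : Finset ((ℕ × ℕ) × (ℕ × ℕ)) :=
  (((Finset.range (s / 2 - 1)) ×ˢ (Finset.range (2 * s))).image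
      fun p => ((p.1, p.2), (p.1 + 1, p.2)))
    ∪ (((Finset.range (s / 2 - 1)) ×ˢ (Finset.range (2 * s - 1))).image
      fun p => ((p.1, p.2), (p.1 + 1, p.2 + 1)))

/-- The graph `G_{n,α}`: horizontal edges have weight `1` and the diagonal edge leaving
layer `x` has weight `(2αn)^{q_x}`, with `q` the bit-reversal permutation. -/
noncomputable def gridGraph (n : ℕ) (α : ℝ) : WDigraph (ℕ × ℕ) :=
  ⟨gridEdges (Nat.sqrt n),
    fun e => if e.2.2 = e.1.2 then 1
      else (2 * α * (n : ℝ)) ^ bitRev (Nat.log 2 (Nat.sqrt n / 2)) e.1.1⟩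

/-- The second coordinate of the vertex of the critical path with parameters `(y0, d)`
in layer `i`: the path takes the diagonal edge exactly at layers `j` with `q_j < d`. -/
def critY (m y0 d i : ℕ) : ℕ := y0 + ((Finset.range i).filter fun j => bitRev m j < d).card

/-- The critical path with parameters `(y0, d)`. -/
def critPath (s m y0 d : ℕ) : List (ℕ × ℕ) :=
  (List.range (s / 2)).map fun i => (i, critY m y0 d i)

/-- The set of critical paths: one for each start `(0,y0)` with `y0 < √n` and each
`d ∈ {1,…,√n}`. -/
def critSetN (n : ℕ) : Finset (List (ℕ × ℕ)) :=
  ((Finset.range (Nat.sqrt n)) ×ˢ (Finset.Icc 1 (Nat.sqrt n))).image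
    fun pd => critPath (Nat.sqrt n) (Nat.log 2 (Nat.sqrt n / 2)) pd.1 pd.2

theorem bitRev_succ (m i : ℕ) :
    bitRev (m + 1) i = 2 * bitRev m i + if i.testBit m then 1 else 0 := by
  unfold bitRev
  rw [Finset.sum_range_succ, Finset.mul_sum]
  congr 1
  · refine Finset.sum_congr rfl fun j hj => ?_
    have hj := Finset.mem_range.1 hj
    have e : m + 1 - 1 - j = (m - 1 - j) + 1 := by omega
    rw [e, pow_succ]
    split_ifs <;> ring
  · simp

theorem bitRev_succ' (m i : ℕ) :
    bitRev (m + 1) i = 2 ^ m * (i % 2) + bitRev m (i / 2) := by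
  unfold bitRev
  rw [Finset.sum_range_succ', add_comm]
  congr 1
  · rcases Nat.mod_two_eq_zero_or_one i with h | h <;> simp [Nat.testBit_zero, h]
  · refine Finset.sum_congr rfl fun j hj => ?_
    rw [Nat.testBit_succ]
    congr 2
    omega

theorem bitRev_lt (m i : ℕ) : bitRev m i < 2 ^ m := by
  induction m with
  | zero => simp [bitRev]
  | succ m ih =>
    rw [bitRev_succ, pow_succ]
    split_ifs <;> omega

theorem bitRev_two_pow_sub_one (m : ℕ) : bitRev m (2 ^ m - 1) = 2 ^ m - 1 := by
  induction m with
  | zero => simp [bitRev]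
  | succ m ih =>
    have h := Nat.two_pow_pos m
    have h1 : (2 ^ (m + 1) - 1) % 2 = 1 := by omega
    have h2 : (2 ^ (m + 1) - 1) / 2 = 2 ^ m - 1 := by omega
    rw [bitRev_succ', h1, h2, ih]
    omega

theorem bitRev_mod (m i : ℕ) : bitRev m (i % 2 ^ m) = bitRev m i := by
  unfold bitRev
  refine Finset.sum_congr rfl fun j hj => ?_
  simp [Nat.testBit_mod_two_pow, Finset.mem_range.1 hj]

theorem bitRev_add_div (b e i : ℕ) : bitRev (b + e) i / 2 ^ e = bitRev b i := by
  induction e with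
  | zero => simp
  | succ e ih =>
    rw [← add_assoc, bitRev_succ, pow_succ', ← Nat.div_div_eq_div_mul, ← ih]
    congr 1
    split_ifs <;> omega

theorem exists_bitRev_eq {m t : ℕ} (ht : t < 2 ^ m) : ∃ j < 2 ^ m, bitRev m j = t := by
  induction m generalizing t with
  | zero => exact ⟨0, by simp, by simp [bitRev]; omega⟩
  | succ m ih =>
    rw [pow_succ'] at ht ⊢
    rcases lt_or_ge t (2 ^ m) with h | h
    · obtain ⟨j, hj, rfl⟩ := ih h
      refine ⟨2 * j, by omega, ?_⟩
      rw [bitRev_succ']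
      simp
    · obtain ⟨j, hj, hjt⟩ := ih (t := t - 2 ^ m) (by omega)
      refine ⟨2 * j + 1, by omega, ?_⟩
      have h1 : (2 * j + 1) % 2 = 1 := by omega
      have h2 : (2 * j + 1) / 2 = j := by omega
      rw [bitRev_succ', h1, h2, hjt]
      omega

/-- Among `2 ^ b` consecutive indices, bit reversal meets every dyadic block of
length `2 ^ e`. -/
theorem exists_bitRev_div_eq (b e a : ℕ) {t : ℕ} (ht : t < 2 ^ b) :
    ∃ j, a ≤ j ∧ j < a + 2 ^ b ∧ bitRev (b + e) j / 2 ^ e = t := by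
  obtain ⟨i, hi, rfl⟩ := exists_bitRev_eq ht
  have hd := Nat.div_add_mod (a + 2 ^ b - 1 - i) (2 ^ b)
  have hm := Nat.mod_lt (a + 2 ^ b - 1 - i) (Nat.two_pow_pos b)
  refine ⟨i + 2 ^ b * ((a + 2 ^ b - 1 - i) / 2 ^ b), by omega, by omega, ?_⟩
  rw [bitRev_add_div, ← bitRev_mod, Nat.add_mul_mod_self_left, Nat.mod_eq_of_lt hi]

/-- A set of values of `bitRev m` avoided on `[a, a + L)` and containing an interval of
length `D` forces `L` and `D` to be small. -/
theorem mul_le_of_bitRev_avoids {m a L c D : ℕ} (hL : L < 2 ^ m) (hD : c + D ≤ 2 ^ m)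
    (hav : ∀ j, a ≤ j → j < a + L → ¬ (c ≤ bitRev m j ∧ bitRev m j < c + D)) :
    (L + 1) * (D + 1) ≤ 4 * 2 ^ m := by
  rcases Nat.eq_zero_or_pos L with rfl | hLpos
  · have := Nat.two_pow_pos m
    omega
  obtain ⟨b, hb⟩ : ∃ b, b = Nat.log 2 L := ⟨_, rfl⟩
  have hb1 : 2 ^ b ≤ L := hb ▸ Nat.pow_log_le_self 2 hLpos.ne'
  have hb2 : L < 2 ^ (b + 1) := hb ▸ Nat.lt_pow_succ_log_self one_lt_two L
  have hbm : b ≤ m := ((Nat.pow_lt_pow_iff_right one_lt_two).1 (hb1.trans_lt hL)).le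
  obtain ⟨e, rfl⟩ := Nat.exists_eq_add_of_le hbm
  have hr := Nat.two_pow_pos e
  have hDr : D + 1 < 2 * 2 ^ e := by
    by_contra! hcon
    have hd := Nat.div_add_mod (c + 2 ^ e - 1) (2 ^ e)
    have hm := Nat.mod_lt (c + 2 ^ e - 1) hr
    obtain ⟨t, ht⟩ : ∃ t, t = (c + 2 ^ e - 1) / 2 ^ e := ⟨_, rfl⟩
    rw [← ht] at hd
    have htb : t < 2 ^ b := by
      by_contra! h
      have h1 : 2 ^ e * 2 ^ b ≤ 2 ^ e * t := Nat.mul_le_mul_left _ h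
      rw [pow_add, mul_comm] at hD
      omega
    obtain ⟨j, hj1, hj2, hjt⟩ := exists_bitRev_div_eq b e a htb
    refine hav j hj1 (by omega) ?_
    have hd' := Nat.div_add_mod (bitRev (b + e) j) (2 ^ e)
    have hm' := Nat.mod_lt (bitRev (b + e) j) hr
    rw [hjt] at hd'
    constructor <;> omega
  calc (L + 1) * (D + 1) ≤ 2 ^ (b + 1) * (2 * 2 ^ e) := Nat.mul_le_mul hb2 hDr.le
    _ = 4 * 2 ^ (b + e) := by ring

theorem critY_min (m y d i : ℕ) : critY m y (min d (2 ^ m)) i = critY m y d i := by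
  unfold critY
  simp [bitRev_lt]

theorem critY_zero (m y d : ℕ) : critY m y d 0 = y := by simp [critY]

theorem critY_eq_add (m y d : ℕ) {i k : ℕ} (h : i ≤ k) :
    critY m y d k = critY m y d i + #{j ∈ Ico i k | bitRev m j < d} := by
  unfold critY
  rw [add_assoc, Finset.range_eq_Ico, Finset.range_eq_Ico, ← Finset.card_union_of_disjoint,
    ← Finset.filter_union, Finset.Ico_union_Ico_eq_Ico (Nat.zero_le i) h]
  exact Finset.disjoint_filter_filter (Finset.Ico_disjoint_Ico_consecutive 0 i k)

theorem critY_succ (m y d i : ℕ) :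
    critY m y d (i + 1) = critY m y d i + if bitRev m i < d then 1 else 0 := by
  rw [critY_eq_add m y d (Nat.le_succ i)]
  simp [Finset.filter_singleton, apply_ite Finset.card]

/-- If two critical paths meet in two layers, then no layer in between separates them. -/
theorem not_bitRev_between {m y y' d d' i k : ℕ} (hd : d ≤ d') (hik : i ≤ k)
    (hi : critY m y d i = critY m y' d' i) (hk : critY m y d k = critY m y' d' k) :
    ∀ j, i ≤ j → j < k → ¬ (d ≤ bitRev m j ∧ bitRev m j < d') := by
  rintro j hij hjk ⟨h1, h2⟩
  rw [critY_eq_add m y d hik, critY_eq_add m y' d' hik, hi] at hk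
  have hsub : {j ∈ Ico i k | bitRev m j < d} ⊆ {j ∈ Ico i k | bitRev m j < d'} :=
    Finset.monotone_filter_right _ fun _ _ h => lt_of_lt_of_le h hd
  have heq := Finset.eq_of_subset_of_card_le hsub (by omega)
  have hj : j ∈ {j ∈ Ico i k | bitRev m j < d'} := by simp [hij, hjk, h2]
  rw [← heq] at hj
  exact absurd (Finset.mem_filter.1 hj).2 (by omega)

theorem mem_critPath {s m y d : ℕ} {p : ℕ × ℕ} :
    p ∈ critPath s m y d ↔ p.1 < s / 2 ∧ critY m y d p.1 = p.2 := by
  unfold critPath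
  simp only [List.mem_map, List.mem_range]
  constructor
  · rintro ⟨i, hi, rfl⟩
    exact ⟨hi, rfl⟩
  · rintro ⟨h1, h2⟩
    exact ⟨p.1, h1, by rw [h2]⟩

theorem critPath_min (s m y d : ℕ) :
    critPath s m y (min d (2 ^ m)) = critPath s m y d := by
  simp [critPath, critY_min]

theorem sqrt_four_pow (k : ℕ) : Nat.sqrt (4 ^ k) = 2 ^ k := by
  rw [show 4 ^ k = 2 ^ k * 2 ^ k by
    rw [← mul_pow]
    norm_num, Nat.sqrt_eq]

theorem mem_critSetN {m : ℕ} {l : List (ℕ × ℕ)} :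
    l ∈ critSetN (4 ^ (m + 1)) ↔ ∃ y d, y < 2 ^ (m + 1) ∧ 1 ≤ d ∧ d ≤ 2 ^ (m + 1) ∧
      critPath (2 ^ (m + 1)) m y d = l := by
  have h2 : 2 ^ (m + 1) / 2 = 2 ^ m := by omega
  simp [critSetN, sqrt_four_pow, h2, Nat.log_pow, and_assoc]

theorem critPath_injOn (m : ℕ) :
    Set.InjOn (fun p : ℕ × ℕ => critPath (2 ^ (m + 1)) m p.1 p.2)
      (range (2 ^ (m + 1)) ×ˢ Icc 1 (2 ^ m - 2 ^ m / 2) : Finset (ℕ × ℕ)) := by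
  have hpos := Nat.two_pow_pos m
  have h2 : 2 ^ (m + 1) / 2 = 2 ^ m := by omega
  have key : ∀ y d y' d', d < d' → 1 ≤ d → d' ≤ 2 ^ m - 2 ^ m / 2 →
      critPath (2 ^ (m + 1)) m y d ≠ critPath (2 ^ (m + 1)) m y' d' := by
    intro y d y' d' hlt h1 hle heq
    have hY : ∀ i < 2 ^ m, critY m y d i = critY m y' d' i := by
      intro i hi
      have hmem : (i, critY m y d i) ∈ critPath (2 ^ (m + 1)) m y d :=
        mem_critPath.2 ⟨by simpa [h2] using hi, rfl⟩
      rw [heq] at hmem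
      exact (mem_critPath.1 hmem).2.symm
    obtain ⟨j, hj, hjd⟩ := exists_bitRev_eq (m := m) (t := d) (by omega)
    have hne : j ≠ 2 ^ m - 1 := by
      rintro rfl
      rw [bitRev_two_pow_sub_one] at hjd
      omega
    exact not_bitRev_between hlt.le (Nat.le_succ j) (hY j hj) (hY (j + 1) (by omega)) j
      le_rfl (Nat.lt_succ_self j) ⟨by omega, by omega⟩
  rintro ⟨y, d⟩ hp ⟨y', d'⟩ hp' heq
  simp only [Finset.coe_product, Set.mem_prod, Finset.mem_coe, Finset.mem_Icc] at hp hp'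
  rcases lt_trichotomy d d' with h | rfl | h
  · exact absurd heq (key _ _ _ _ h hp.2.1 hp'.2.2)
  · have hmem : (0, y) ∈ critPath (2 ^ (m + 1)) m y d :=
      mem_critPath.2 ⟨by simp [h2], critY_zero _ _ _⟩
    simp only at heq
    rw [heq] at hmem
    have := (mem_critPath.1 hmem).2
    rw [critY_zero] at this
    rw [this]
  · exact absurd heq.symm (key _ _ _ _ h hp'.2.1 hp.2.2)

theorem card_critSetN_bounds (m : ℕ) :
    4 ^ (m + 1) ≤ 4 * #(critSetN (4 ^ (m + 1))) ∧ #(critSetN (4 ^ (m + 1))) ≤ 4 ^ (m + 1) := by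
  have hn : (4 : ℕ) ^ (m + 1) = 2 ^ (m + 1) * 2 ^ (m + 1) := by
    rw [← mul_pow]
    norm_num
  constructor
  · have hsub : (range (2 ^ (m + 1)) ×ˢ Icc 1 (2 ^ m - 2 ^ m / 2)).image
        (fun p : ℕ × ℕ => critPath (2 ^ (m + 1)) m p.1 p.2) ⊆ critSetN (4 ^ (m + 1)) := by
      intro l hl
      simp only [Finset.mem_image, Finset.mem_product, Finset.mem_range, Finset.mem_Icc] at hl
      obtain ⟨p, ⟨h1, h2, h3⟩, rfl⟩ := hl
      exact mem_critSetN.2 ⟨p.1, p.2, h1, h2, by rw [pow_succ]; omega, rfl⟩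
    have hc := Finset.card_le_card hsub
    rw [Finset.card_image_of_injOn (critPath_injOn m), Finset.card_product, Finset.card_range,
      Nat.card_Icc] at hc
    calc 4 ^ (m + 1) = 2 ^ (m + 1) * 2 ^ (m + 1) := hn
      _ ≤ 2 ^ (m + 1) * (4 * (2 ^ m - 2 ^ m / 2 + 1 - 1)) :=
        Nat.mul_le_mul_left _ (by rw [pow_succ]; omega)
      _ ≤ 4 * #(critSetN (4 ^ (m + 1))) := by
        rw [mul_left_comm]
        exact Nat.mul_le_mul_left _ hc
  · unfold critSetN
    refine Finset.card_image_le.trans ?_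
    rw [Finset.card_product, Finset.card_range, Nat.card_Icc, sqrt_four_pow, hn,
      Nat.add_sub_cancel]

theorem length_filter_critPath {s m y d i : ℕ} (hi : i < s / 2) :
    ((critPath s m y d).filter fun v => decide (v.1 = i)).length = 1 := by
  unfold critPath
  rw [← List.countP_eq_length_filter, List.countP_map]
  have h : List.count i (List.range (s / 2)) = 1 :=
    List.count_eq_one_of_mem List.nodup_range (List.mem_range.2 hi)
  rw [← h, List.count]
  rfl

theorem card_mul_card_inter_critPath_le {m : ℕ} {T : Finset (List (ℕ × ℕ))}
    (hT : T ⊆ critSetN (4 ^ (m + 1))) (hne : T.Nonempty) :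
    #(T.inf' hne fun l => l.toFinset) * #T ≤ 4 * 2 ^ m := by
  have h2 : 2 ^ (m + 1) / 2 = 2 ^ m := by omega
  have hex : ∀ l ∈ T, ∃ y d, d ≤ 2 ^ m ∧ critPath (2 ^ (m + 1)) m y d = l := by
    intro l hl
    obtain ⟨y, d, -, -, -, rfl⟩ := mem_critSetN.1 (hT hl)
    exact ⟨y, min d (2 ^ m), min_le_right _ _, critPath_min _ _ _ _⟩
  choose! y d hd hl using hex
  set C := T.inf' hne fun l => l.toFinset
  have hmem : ∀ p ∈ C, ∀ l ∈ T, p.1 < 2 ^ m ∧ critY m (y l) (d l) p.1 = p.2 := by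
    intro p hp l hlT
    have h : p ∈ l.toFinset := Finset.inf'_le (fun l : List (ℕ × ℕ) => l.toFinset) hlT hp
    rw [List.mem_toFinset, ← hl l hlT, mem_critPath, h2] at h
    exact h
  rcases C.eq_empty_or_nonempty with hCe | hCne
  · simp [hCe]
  obtain ⟨l₀, hl₀⟩ := hne
  have hdinj : Set.InjOn d T := by
    intro l hlT l' hlT' hdd
    obtain ⟨p, hp⟩ := hCne
    have e := (hmem p hp l hlT).2.trans (hmem p hp l' hlT').2.symm
    rw [hdd] at e
    rw [← hl l hlT, ← hl l' hlT', hdd, Nat.add_right_cancel e]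
  have hfinj : Set.InjOn Prod.fst (C : Set (ℕ × ℕ)) := by
    intro p hp p' hp' h
    refine Prod.ext h ?_
    rw [← (hmem p hp l₀ hl₀).2, ← (hmem p' hp' l₀ hl₀).2, h]
  obtain ⟨p₁, hp₁, hmin⟩ := Finset.exists_min_image C Prod.fst hCne
  obtain ⟨p₂, hp₂, hmax⟩ := Finset.exists_max_image C Prod.fst hCne
  obtain ⟨l₁, hl₁, hdmin⟩ := Finset.exists_min_image T d ⟨l₀, hl₀⟩
  obtain ⟨l₂, hl₂, hdmax⟩ := Finset.exists_max_image T d ⟨l₀, hl₀⟩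
  have hCcard : #C ≤ p₂.1 - p₁.1 + 1 := by
    rw [← Finset.card_image_of_injOn hfinj]
    refine (Finset.card_le_card (t := Icc p₁.1 p₂.1) ?_).trans ?_
    · exact Finset.image_subset_iff.2 fun p hp => Finset.mem_Icc.2 ⟨hmin p hp, hmax p hp⟩
    · rw [Nat.card_Icc]; omega
  have hTcard : #T ≤ d l₂ - d l₁ + 1 := by
    rw [← Finset.card_image_of_injOn hdinj]
    refine (Finset.card_le_card (t := Icc (d l₁) (d l₂)) ?_).trans ?_
    · exact Finset.image_subset_iff.2 fun l hl => Finset.mem_Icc.2 ⟨hdmin l hl, hdmax l hl⟩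
    · rw [Nat.card_Icc]; omega
  have hpp := hmax p₁ hp₁
  have hdd := hdmax l₁ hl₁
  have hav := not_bitRev_between hdd hpp
    ((hmem p₁ hp₁ l₁ hl₁).2.trans (hmem p₁ hp₁ l₂ hl₂).2.symm)
    ((hmem p₂ hp₂ l₁ hl₁).2.trans (hmem p₂ hp₂ l₂ hl₂).2.symm)
  refine (Nat.mul_le_mul hCcard hTcard).trans
    (mul_le_of_bitRev_avoids (a := p₁.1) (c := d l₁) ?_ ?_ ?_)
  · have := (hmem p₂ hp₂ l₁ hl₁).1
    omega
  · have := hd l₂ hl₂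
    omega
  · rwa [Nat.add_sub_cancel' hpp, Nat.add_sub_cancel' hdd]

theorem mem_gridEdges {s : ℕ} {e : (ℕ × ℕ) × (ℕ × ℕ)} (h : e ∈ gridEdges s) :
    e.2.1 = e.1.1 + 1 ∧ (e.2.2 = e.1.2 ∨ e.2.2 = e.1.2 + 1) := by
  simp only [gridEdges, Finset.mem_union, Finset.mem_image] at h
  rcases h with ⟨p, -, rfl⟩ | ⟨p, -, rfl⟩ <;> simp

/-- A walk in the grid starting in layer `0` is the graph of a function of the layer. -/
theorem exists_eq_map_range_of_isWalkOn {s y : ℕ} {en : ℕ × ℕ} {l : List (ℕ × ℕ)}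
    (h : IsWalkOn (gridEdges s) (0, y) en l) :
    ∃ (N : ℕ) (Y : ℕ → ℕ), l = (List.range (N + 1)).map (fun i => (i, Y i)) ∧ Y 0 = y ∧
      en = (N, Y N) ∧ ∀ i < N, Y (i + 1) = Y i ∨ Y (i + 1) = Y i + 1 := by
  obtain ⟨hc, hh, ht⟩ := h
  have hc := List.isChain_iff_getElem.1 hc
  have hlen : 0 < l.length := by
    rcases l with _ | ⟨a, l⟩
    · simp at hh
    · simp
  have h0 : l[0] = (0, y) := by
    rw [List.head?_eq_getElem?, List.getElem?_eq_getElem hlen] at hh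
    exact Option.some.inj hh
  have hfst : ∀ i (hi : i < l.length), (l[i]).1 = i := by
    intro i
    induction i with
    | zero => intro _; rw [h0]
    | succ i ih =>
      intro hi
      have := (mem_gridEdges (hc i hi)).1
      simp only [ih (by omega)] at this
      exact this
  have hY : ∀ i (hi : i < l.length), (l.getD i (0, 0)) = l[i] := fun i hi => by
    simp [List.getD_eq_getElem?_getD, hi]
  refine ⟨l.length - 1, fun i => (l.getD i (0, 0)).2, ?_, ?_, ?_, ?_⟩
  · refine List.ext_getElem (by simp; omega) fun i h1 h2 => ?_
    rw [List.getElem_map, List.getElem_range]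
    simp only [hY i h1]
    exact Prod.ext (hfst i h1) rfl
  · simp only [hY 0 hlen, h0]
  · rw [List.getLast?_eq_getElem?, List.getElem?_eq_getElem (by omega)] at ht
    rw [← Option.some.inj ht]
    simp only [hY (l.length - 1) (by omega)]
    exact Prod.ext (hfst _ _) rfl
  · intro i hi
    simp only [hY i (by omega), hY (i + 1) (by omega)]
    exact (mem_gridEdges (hc i (by omega))).2

theorem walkWeight_map_range {V : Type} (G : WDigraph V) (N : ℕ) (g : ℕ → V) :
    G.walkWeight ((List.range (N + 1)).map g) = ∑ i ∈ range N, G.w (g i, g (i + 1)) := by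
  have h : ((List.range (N + 1)).map g).zip ((List.range (N + 1)).map g).tail =
      (List.range N).map fun i => (g i, g (i + 1)) := by
    refine List.ext_getElem (by simp) fun i h1 h2 => ?_
    simp
  rw [WDigraph.walkWeight, h, List.map_map]
  rfl

theorem eq_add_card_of_unit_steps {N : ℕ} {Y : ℕ → ℕ}
    (hY : ∀ i < N, Y (i + 1) = Y i ∨ Y (i + 1) = Y i + 1) :
    ∀ i ≤ N, Y i = Y 0 + #{j ∈ range i | Y (j + 1) = Y j + 1} := by
  intro i
  induction i with
  | zero => simp
  | succ i ih =>
    intro hi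
    rw [Finset.range_add_one, Finset.filter_insert]
    have h := ih (by omega)
    rcases hY i hi with h' | h'
    · rw [if_neg (by omega)]; omega
    · rw [if_pos h', Finset.card_insert_of_notMem (by simp)]; omega

/-- A unit-step function agreeing with `critY` at both ends but not everywhere steps up at
some layer where `critY` does not. -/
theorem exists_step_of_ne_critY {m d N : ℕ} {Y : ℕ → ℕ}
    (hY : ∀ i < N, Y (i + 1) = Y i ∨ Y (i + 1) = Y i + 1)
    (hN : Y N = critY m (Y 0) d N) (hne : ∃ i ≤ N, Y i ≠ critY m (Y 0) d i) :
    ∃ j < N, d ≤ bitRev m j ∧ Y (j + 1) = Y j + 1 := by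
  by_contra! hcon
  have hcard := eq_add_card_of_unit_steps hY
  have hsub : {j ∈ range N | Y (j + 1) = Y j + 1} ⊆ {j ∈ range N | bitRev m j < d} := by
    intro j hj
    simp only [Finset.mem_filter, Finset.mem_range] at hj ⊢
    refine ⟨hj.1, ?_⟩
    by_contra! h
    exact hcon j hj.1 h hj.2
  have heq := Finset.eq_of_subset_of_card_le hsub (by
    have := hcard N le_rfl
    unfold critY at hN
    omega)
  obtain ⟨i, hi, hine⟩ := hne
  apply hine
  rw [hcard i hi, critY]
  congr 2
  ext j
  simp only [Finset.mem_filter, Finset.mem_range]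
  refine and_congr_right fun hj => ?_
  have := Finset.ext_iff.1 heq j
  simpa [lt_of_lt_of_le hj hi] using this

theorem mul_walkWeight_critPath_lt {m y d : ℕ} (hd : 1 ≤ d) {α : ℝ} (hα : 1 ≤ α)
    {st en : ℕ × ℕ} {l' : List (ℕ × ℕ)}
    (hst : (critPath (2 ^ (m + 1)) m y d).head? = some st)
    (hen : (critPath (2 ^ (m + 1)) m y d).getLast? = some en)
    (hw : (gridGraph (4 ^ (m + 1)) α).IsWalk st en l')
    (hne : l' ≠ critPath (2 ^ (m + 1)) m y d) :
    α * (gridGraph (4 ^ (m + 1)) α).walkWeight (critPath (2 ^ (m + 1)) m y d) <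
      (gridGraph (4 ^ (m + 1)) α).walkWeight l' := by
  have h2 : 2 ^ (m + 1) / 2 = 2 ^ m := by omega
  obtain ⟨M, hM⟩ : ∃ M, 2 ^ m = M + 1 := ⟨2 ^ m - 1, by have := Nat.two_pow_pos m; omega⟩
  have hl : critPath (2 ^ (m + 1)) m y d =
      (List.range (M + 1)).map fun i => (i, critY m y d i) := by
    rw [critPath, h2, hM]
  rw [hl] at hst hen hne ⊢
  have hst' : st = (0, y) := by
    rw [List.range_succ_eq_map] at hst
    simpa [critY_zero] using hst.symm
  have hen' : en = (M, critY m y d M) := by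
    rw [List.range_succ] at hen
    simpa using hen.symm
  subst hst'
  obtain ⟨N, Y, rfl, rfl, hN, hstep⟩ := exists_eq_map_range_of_isWalkOn hw
  rw [hN, Prod.mk.injEq] at hen'
  obtain ⟨rfl, hYN⟩ := hen'
  obtain ⟨j, hj, hdj, hYj⟩ := exists_step_of_ne_critY hstep hYN (by
    by_contra! h
    refine hne (List.map_congr_left fun i hi => ?_)
    rw [h i (by simpa [Nat.lt_succ_iff] using hi)])
  rw [walkWeight_map_range, walkWeight_map_range]
  simp only [gridGraph, sqrt_four_pow, h2, Nat.log_pow one_lt_two]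
  obtain ⟨n, hn⟩ : ∃ n : ℕ, n = 4 ^ (m + 1) := ⟨_, rfl⟩
  have hNn : N < n := by
    have : 2 ^ m ≤ 4 ^ (m + 1) :=
      (Nat.pow_le_pow_left (by norm_num) m).trans (Nat.pow_le_pow_right (by norm_num) (by omega))
    omega
  rw [← hn]
  have hNn' : (N : ℝ) < n := by exact_mod_cast hNn
  have hn1 : (1 : ℝ) ≤ n := by exact_mod_cast (by omega : 1 ≤ n)
  obtain ⟨W, hW⟩ : ∃ W : ℝ, W = 2 * α * n := ⟨_, rfl⟩
  rw [← hW]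
  have hW1 : 1 ≤ W := by nlinarith
  have hWp : 0 < W ^ (d - 1) := by positivity
  have hupper : (∑ i ∈ range N, if critY m (Y 0) d (i + 1) = critY m (Y 0) d i then (1 : ℝ)
      else W ^ bitRev m i) ≤ N * W ^ (d - 1) := by
    refine (Finset.sum_le_card_nsmul _ _ (W ^ (d - 1)) fun i _ => ?_).trans_eq (by simp)
    rw [critY_succ]
    by_cases hi : bitRev m i < d
    · simpa [hi] using pow_le_pow_right₀ hW1 (by omega : bitRev m i ≤ d - 1)
    · simpa [hi] using one_le_pow₀ hW1
  have hlower : W ^ d ≤ ∑ i ∈ range N, if Y (i + 1) = Y i then (1 : ℝ) else W ^ bitRev m i := by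
    refine (pow_le_pow_right₀ hW1 hdj).trans ?_
    have := Finset.single_le_sum
      (f := fun i => if Y (i + 1) = Y i then (1 : ℝ) else W ^ bitRev m i)
      (fun i _ => by split_ifs <;> positivity) (Finset.mem_range.2 hj)
    simpa [hYj] using this
  calc _ ≤ α * (N * W ^ (d - 1)) := by gcongr
    _ < W * W ^ (d - 1) := by
      rw [← mul_assoc]
      refine mul_lt_mul_of_pos_right ?_ hWp
      nlinarith
    _ = W ^ d := by rw [← pow_succ', Nat.sub_add_cancel hd]
    _ ≤ _ := hlower

/-- properties of the grid construction `G_{n,α}` with critical paths `P`: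
(a) `|P| = Θ(n)` and each critical path meets every layer in exactly one vertex;
(b) each critical path is the unique α-approximate shortest path between its endpoints;
(c) any `k` distinct critical paths share at most `2√n/k` vertices. -/
theorem grid_construction_properties :
    ∃ c C : ℝ, 0 < c ∧ 0 < C ∧
      ∀ n : ℕ, (∃ k : ℕ, 0 < k ∧ n = 4 ^ k) → ∀ α : ℝ, 1 ≤ α →
        -- (a)
        ((c * (n : ℝ) ≤ ((critSetN n).card : ℝ) ∧ ((critSetN n).card : ℝ) ≤ C * (n : ℝ)) ∧
          (∀ l ∈ critSetN n, ∀ i < Nat.sqrt n / 2,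
            (l.filter fun v => decide (v.1 = i)).length = 1)) ∧
        -- (b)
        (∀ l ∈ critSetN n, ∀ st en : ℕ × ℕ, l.head? = some st → l.getLast? = some en →
          ∀ l', (gridGraph n α).IsWalk st en l' → l' ≠ l →
            α * (gridGraph n α).walkWeight l < (gridGraph n α).walkWeight l') ∧
        -- (c)
        (∀ T : Finset (List (ℕ × ℕ)), T ⊆ critSetN n → ∀ hT : T.Nonempty,
          (((T.inf' hT fun l => l.toFinset).card : ℝ)) ≤ 2 * Real.sqrt n / (T.card : ℝ)) := by
  refine ⟨1 / 4, 1, by norm_num, by norm_num, ?_⟩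
  rintro n ⟨k, hk, rfl⟩ α hα
  obtain ⟨m, rfl⟩ : ∃ m, k = m + 1 := ⟨k - 1, by omega⟩
  refine ⟨⟨⟨?_, ?_⟩, ?_⟩, ?_, ?_⟩
  · have : ((4 ^ (m + 1) : ℕ) : ℝ) ≤ 4 * (#(critSetN (4 ^ (m + 1))) : ℝ) := by
      exact_mod_cast (card_critSetN_bounds m).1
    linarith
  · rw [one_mul]
    exact_mod_cast (card_critSetN_bounds m).2
  · intro l hl i hi
    rw [sqrt_four_pow] at hi
    obtain ⟨y, d, -, -, -, rfl⟩ := mem_critSetN.1 hl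
    exact length_filter_critPath hi
  · intro l hl st en hst hen l' hw hne
    obtain ⟨y, d, -, hd, -, rfl⟩ := mem_critSetN.1 hl
    exact mul_walkWeight_critPath_lt hd hα hst hen hw hne
  · intro T hT hne
    have hsqrt : Real.sqrt ((4 ^ (m + 1) : ℕ) : ℝ) = 2 * 2 ^ m := by
      rw [show ((4 ^ (m + 1) : ℕ) : ℝ) = (2 * 2 ^ m) ^ 2 by
        push_cast; rw [← pow_succ', ← pow_mul, mul_comm, pow_mul]; norm_num]
      exact Real.sqrt_sq (by positivity)
    rw [le_div_iff₀ (by exact_mod_cast hne.card_pos), hsqrt]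
    have h : ((#(T.inf' hne fun l => l.toFinset) : ℕ) : ℝ) * #T ≤ 4 * 2 ^ m := by
      exact_mod_cast card_mul_card_inter_critPath_le hT hne
    linarith
end

section
/- For every constant c > 0 there exist a constant c' > 0 and infinitely many n for which there exists an n-vertex undirected unweighted graph G with m edges with the following property: for every exact hopset H of G with |H| ≤ c·m, there exists a pair of vertices (s,t) in the same connected component such that every path from s to t in G ∪ H of total weight exactly dist_G(s,t) has more than c'·n^{2/7} edges; that is, every exact hopset of size at most c·m has hopbound at least c'·n^{2/7}. -/
/-- An undirected weighted graph: a finite set of undirected edges together with weights. -/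
structure WGraph (V : Type) where
  Edge : Finset (Sym2 V)
  w : Sym2 V → ℝ

namespace WGraph

variable {V : Type}

def walkWeight (G : WGraph V) (l : List V) : ℝ :=
  ((l.zip l.tail).map fun p => G.w s(p.1, p.2)).sum

def IsWalkOn (F : Finset (Sym2 V)) (s t : V) (l : List V) : Prop :=
  l.Chain' (fun a b => s(a, b) ∈ F) ∧ l.head? = some s ∧ l.getLast? = some t

noncomputable def distOn (G : WGraph V) (F : Finset (Sym2 V)) (s t : V) : ℝ :=
  sInf {x | ∃ l, IsWalkOn F s t l ∧ G.walkWeight l = x}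

def IsWalk (G : WGraph V) (s t : V) (l : List V) : Prop := IsWalkOn G.Edge s t l

def Reachable (G : WGraph V) (s t : V) : Prop := ∃ l, G.IsWalk s t l

noncomputable def dist (G : WGraph V) (s t : V) : ℝ := G.distOn G.Edge s t

def PosWeights (G : WGraph V) : Prop := ∀ e ∈ G.Edge, 0 < G.w e

def Unweighted (G : WGraph V) : Prop := ∀ e ∈ G.Edge, G.w e = 1

def IsExactPreserver (G : WGraph V) (F : Finset (Sym2 V)) (P : Finset (V × V)) : Prop :=
  F ⊆ G.Edge ∧ ∀ q ∈ P, (∃ l, IsWalkOn F q.1 q.2 l) ∧ G.distOn F q.1 q.2 = G.dist q.1 q.2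

end WGraph

/-- The weight of a walk in `G ∪ H`, where `H` is a set of additional (hopset) edges
each weighted by the `G`-distance between its endpoints, and edges of `G` keep their
weight. -/
noncomputable def hopWalkWeight {V : Type} [DecidableEq V] (G : WGraph V)
    (H : Finset (Sym2 V)) (l : List V) : ℝ :=
  ((l.zip l.tail).map fun p =>
    if s(p.1, p.2) ∈ G.Edge then G.w s(p.1, p.2) else G.dist p.1 p.2).sum

/-- The bit-reversal of the `q` lowest binary digits of `k`. -/
def bitReversal : ℕ → ℕ → ℕ
  | 0, _ => 0
  | q + 1, k => k % 2 * 2 ^ q + bitReversal q (k / 2)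

theorem bitReversal_lt (q k : ℕ) : bitReversal q k < 2 ^ q := by
  induction q generalizing k with
  | zero => simp [bitReversal]
  | succ q ih =>
    have h := ih (k / 2)
    have h2 : k % 2 * 2 ^ q ≤ 1 * 2 ^ q := Nat.mul_le_mul_right _ (by omega)
    rw [bitReversal, pow_succ]
    omega

/-- Any `2 ^ s` consecutive integers have bit-reversals in every dyadic block of length
`2 ^ (q - s)`. -/
theorem exists_bitReversal_mem_block {q s : ℕ} (hs : s ≤ q) (k₀ : ℕ) {t : ℕ} (ht : t < 2 ^ s) :
    ∃ k, k₀ ≤ k ∧ k < k₀ + 2 ^ s ∧ t * 2 ^ (q - s) ≤ bitReversal q k ∧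
      bitReversal q k < (t + 1) * 2 ^ (q - s) := by
  induction q generalizing s k₀ t with
  | zero =>
    obtain rfl : s = 0 := by omega
    obtain rfl : t = 0 := by simpa using ht
    exact ⟨k₀, le_rfl, by simp, by simp, by simp [bitReversal]⟩
  | succ q ih =>
    cases s with
    | zero =>
      obtain rfl : t = 0 := by simpa using ht
      exact ⟨k₀, le_rfl, by simp, by simp, by simpa using bitReversal_lt (q + 1) k₀⟩
    | succ s =>
      have key : ∀ b t' : ℕ, b < 2 → t' < 2 ^ s → t = b * 2 ^ s + t' →
          ∃ k, k₀ ≤ k ∧ k < k₀ + 2 ^ (s + 1) ∧ t * 2 ^ (q + 1 - (s + 1)) ≤ bitReversal (q + 1) k ∧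
            bitReversal (q + 1) k < (t + 1) * 2 ^ (q + 1 - (s + 1)) := by
        rintro b t' hb ht' rfl
        obtain ⟨m, h1, h2, h3, h4⟩ := ih (by omega : s ≤ q) ((k₀ + 1 - b) / 2) ht'
        have e1 : (2 * m + b) % 2 = b := by omega
        have e2 : (2 * m + b) / 2 = m := by omega
        have e3 : 2 ^ s * 2 ^ (q - s) = 2 ^ q := by rw [← pow_add]; congr 1; omega
        refine ⟨2 * m + b, by omega, by rw [pow_succ]; omega, ?_, ?_⟩
        · rw [bitReversal, e1, e2, Nat.add_sub_add_right, add_mul, mul_assoc, e3]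
          omega
        · rw [bitReversal, e1, e2, Nat.add_sub_add_right, add_assoc, add_mul, mul_assoc, e3]
          omega
      rw [pow_succ] at ht
      by_cases h : t < 2 ^ s
      · exact key 0 t (by omega) h (by omega)
      · exact key 1 (t - 2 ^ s) (by omega) (by omega) (by omega)

namespace HopsetGraph

/-- The two forward edges leaving a point `(i, x, y)`. Layers come in periods of three: in layer
`3k` one either takes two edges to move `x` by `A + v k`, or skips a layer; in layer `3k + 2` one
either moves by `(v k, 1)` or stays. -/
def branch (A : ℕ) (v : ℕ → ℕ) (b : Bool) (p : ℕ × ℕ × ℕ) : ℕ × ℕ × ℕ :=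
  if p.1 % 3 = 0 then (if b then (p.1 + 1, p.2) else (p.1 + 2, p.2))
  else if p.1 % 3 = 1 then (p.1 + 1, p.2.1 + (A + v (p.1 / 3)), p.2.2)
  else if b then (p.1 + 1, p.2.1 + v (p.1 / 3), p.2.2 + 1)
  else (p.1 + 1, p.2)

/-- The branch taken in layer `i` by the critical paths of direction `d`. -/
def choice (v : ℕ → ℕ) (d : ℕ × ℕ) (i : ℕ) : Bool :=
  if i % 3 = 0 then decide (d.1 < v (i / 3)) else decide (d.2 < v (i / 3))

/-- The successor of `p` on the critical path of direction `d` through `p`. -/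
def step (A : ℕ) (v : ℕ → ℕ) (d : ℕ × ℕ) (p : ℕ × ℕ × ℕ) : ℕ × ℕ × ℕ :=
  branch A v (choice v d p.1) p

/-- The scale of the potential of direction `d`: it grows by `scale A d` along each critical edge. -/
def scale (A : ℕ) (d : ℕ × ℕ) : ℤ := 2 * A + 2 * d.1 + 1

def layerPotential (A : ℕ) (v : ℕ → ℕ) (d : ℕ × ℕ) : ℕ → ℤ
  | 0 => 0
  | i + 1 => layerPotential A v d i +
      (if i % 3 = 0 then min (2 * ((A : ℤ) + (v (i / 3) : ℤ))) (scale A d)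
      else if i % 3 = 1 then scale A d - 2 * ((A : ℤ) + (v (i / 3) : ℤ))
      else scale A d - max 0 (2 * (v (i / 3) : ℤ) - (2 * (d.2 : ℤ) + 1)))

def potential (A : ℕ) (v : ℕ → ℕ) (d : ℕ × ℕ) (p : ℕ × ℕ × ℕ) : ℤ :=
  2 * p.2.1 - (2 * d.2 + 1) * p.2.2 + layerPotential A v d p.1

variable {A : ℕ} {v : ℕ → ℕ} {d : ℕ × ℕ}

theorem scale_pos : 0 < scale A d := by unfold scale; positivity

theorem fst_branch (b : Bool) (p : ℕ × ℕ × ℕ) :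
    p.1 + 1 ≤ (branch A v b p).1 ∧ (branch A v b p).1 ≤ p.1 + 2 := by
  unfold branch
  split_ifs <;> simp

theorem le_branch (b : Bool) (p : ℕ × ℕ × ℕ) : p ≤ branch A v b p := by
  unfold branch
  split_ifs <;> simp [Prod.le_def]

theorem potential_branch (hv : ∀ k, v k < A) (h2 : d.2 < A)
    (b : Bool) (p : ℕ × ℕ × ℕ) :
    potential A v d (branch A v b p) - potential A v d p ≤ scale A d ∧
    potential A v d p - potential A v d (branch A v b p) < scale A d ∧
    (potential A v d (branch A v b p) - potential A v d p = scale A d →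
      branch A v b p = step A v d p) := by
  obtain ⟨i, x, y⟩ := p
  have hk := hv (i / 3)
  unfold step
  by_cases h0 : i % 3 = 0
  · have e1 : (i + 1) % 3 = 1 := by omega
    have e2 : (i + 1) / 3 = i / 3 := by omega
    by_cases hd : d.1 < v (i / 3) <;> cases b <;>
      simp [branch, choice, potential, layerPotential, h0, e1, e2, scale, hd] <;> omega
  by_cases h1 : i % 3 = 1
  · simp [branch, potential, layerPotential, h1, scale]
    omega
  · by_cases hd : d.2 < v (i / 3) <;> cases b <;>
      simp [branch, choice, potential, layerPotential, h0, h1, scale, hd, mul_add] <;> omega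

theorem potential_step (p : ℕ × ℕ × ℕ) :
    potential A v d (step A v d p) = potential A v d p + scale A d := by
  obtain ⟨i, x, y⟩ := p
  unfold step
  by_cases h0 : i % 3 = 0
  · have e1 : (i + 1) % 3 = 1 := by omega
    have e2 : (i + 1) / 3 = i / 3 := by omega
    by_cases hd : d.1 < v (i / 3) <;>
      simp [branch, choice, potential, layerPotential, h0, e1, e2, scale, hd] <;> omega
  by_cases h1 : i % 3 = 1
  · simp [branch, potential, layerPotential, h1, scale]
    omega
  · by_cases hd : d.2 < v (i / 3) <;>
      simp [branch, choice, potential, layerPotential, h0, h1, scale, hd, mul_add] <;> omega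

theorem fst_step_of_ne {i : ℕ} (hi : i % 3 ≠ 1) {p : ℕ × ℕ × ℕ} (hp : p.1 < i)
    (h : i ≤ (step A v d p).1) : (step A v d p).1 = i := by
  have h2 := (fst_branch (A := A) (v := v) (choice v d p.1) p).2
  by_cases h0 : p.1 % 3 = 0
  · change (branch A v _ p).1 ≤ _ at h2
    unfold step at h ⊢
    omega
  · have : (step A v d p).1 = p.1 + 1 := by
      unfold step branch
      split_ifs <;> simp
    omega

theorem add_le_fst_iterate (e : ℕ) (p : ℕ × ℕ × ℕ) : p.1 + e ≤ ((step A v d)^[e] p).1 := by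
  induction e with
  | zero => simp
  | succ e ih =>
    rw [Function.iterate_succ_apply']
    have := (fst_branch (A := A) (v := v) (choice v d ((step A v d)^[e] p).1)
      ((step A v d)^[e] p)).1
    unfold step at *
    omega

theorem le_iterate (e : ℕ) (p : ℕ × ℕ × ℕ) : p ≤ (step A v d)^[e] p := by
  induction e with
  | zero => simp
  | succ e ih =>
    rw [Function.iterate_succ_apply']
    exact ih.trans (le_branch _ _)

/-- Critical paths can only skip the layers that are congruent to `1` modulo `3`. -/
theorem exists_fst_iterate_eq {i : ℕ} (hi : i % 3 ≠ 1) {p : ℕ × ℕ × ℕ} (hp : p.1 ≤ i) {e : ℕ}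
    (he : i ≤ ((step A v d)^[e] p).1) : ∃ e₀ ≤ e, ((step A v d)^[e₀] p).1 = i := by
  induction e with
  | zero => exact ⟨0, le_rfl, le_antisymm hp he⟩
  | succ e ih =>
    by_cases h : i ≤ ((step A v d)^[e] p).1
    · obtain ⟨e₀, h1, h2⟩ := ih h
      exact ⟨e₀, by omega, h2⟩
    · refine ⟨e + 1, le_rfl, ?_⟩
      rw [Function.iterate_succ_apply'] at he ⊢
      exact fst_step_of_ne hi (by omega) he

theorem potential_iterate (e : ℕ) (p : ℕ × ℕ × ℕ) :
    potential A v d ((step A v d)^[e] p) = potential A v d p + e * scale A d := by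
  induction e with
  | zero => simp
  | succ e ih =>
    rw [Function.iterate_succ_apply', potential_step, ih]
    push_cast
    ring

theorem potential_iterate_le (hv : ∀ k, v k < A) (h2 : d.2 < A) (d' : ℕ × ℕ) (e : ℕ)
    (p : ℕ × ℕ × ℕ) :
    potential A v d ((step A v d')^[e] p) ≤ potential A v d p + e * scale A d ∧
    (potential A v d ((step A v d')^[e] p) = potential A v d p + e * scale A d →
      ∀ e₀ ≤ e, (step A v d')^[e₀] p = (step A v d)^[e₀] p) := by
  induction e with
  | zero => simp
  | succ e ih =>
    obtain ⟨h3, h4⟩ := ih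
    obtain ⟨h5, -, h6⟩ := potential_branch hv h2 (choice v d' ((step A v d')^[e] p).1)
      ((step A v d')^[e] p)
    rw [Function.iterate_succ_apply']
    change potential A v d (step A v d' _) - _ ≤ _ at h5
    change potential A v d (step A v d' _) - _ = _ → step A v d' _ = _ at h6
    push_cast
    refine ⟨by linarith, fun h e₀ he₀ => ?_⟩
    obtain h7 | rfl := Nat.le_succ_iff.mp he₀
    · exact h4 (by linarith) e₀ h7
    · rw [Function.iterate_succ_apply', Function.iterate_succ_apply', h6 (by linarith),
        h4 (by linarith) e le_rfl]

/-- Critical subpaths of different directions with common endpoints coincide. -/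
theorem iterate_eq_iterate (hv : ∀ k, v k < A) {d' : ℕ × ℕ} (h2 : d.2 < A) (h2' : d'.2 < A)
    {e e' : ℕ} {p : ℕ × ℕ × ℕ} (h : (step A v d)^[e] p = (step A v d')^[e'] p) :
    e = e' ∧ ∀ e₀ ≤ e, (step A v d)^[e₀] p = (step A v d')^[e₀] p := by
  obtain ⟨h3, h4⟩ := potential_iterate_le hv h2 d' e' p
  obtain ⟨h5, -⟩ := potential_iterate_le hv h2' d e p
  rw [← h, potential_iterate] at h3 h4
  rw [h, potential_iterate] at h5
  have s1 := scale_pos (A := A) (d := d)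
  have s2 := scale_pos (A := A) (d := d')
  have e1 : (e : ℤ) ≤ e' := le_of_mul_le_mul_right (by linarith) s1
  have e2 : (e' : ℤ) ≤ e := le_of_mul_le_mul_right (by linarith) s2
  obtain rfl : e = e' := by omega
  exact ⟨rfl, fun e₀ he₀ => (h4 rfl e₀ he₀).symm⟩

theorem lt_iff_lt_of_iterate_eq (hv : ∀ k, v k < A) {d' : ℕ × ℕ} (h2 : d.2 < A) (h2' : d'.2 < A)
    {e e' : ℕ} {p : ℕ × ℕ × ℕ} (h : (step A v d)^[e] p = (step A v d')^[e'] p) {k : ℕ}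
    (hk : p.1 ≤ 3 * k) (hk' : 3 * (k + 1) ≤ ((step A v d)^[e] p).1) :
    (d.1 < v k ↔ d'.1 < v k) ∧ (d.2 < v k ↔ d'.2 < v k) := by
  obtain ⟨-, hag⟩ := iterate_eq_iterate hv h2 h2' h
  have aux : ∀ i, i % 3 ≠ 1 → p.1 ≤ i → i < ((step A v d)^[e] p).1 →
      ∃ r : ℕ × ℕ × ℕ, r.1 = i ∧ step A v d r = step A v d' r := by
    intro i hi hpi hie
    obtain ⟨e₀, h3, h4⟩ := exists_fst_iterate_eq hi hpi hie.le
    have h5 : e₀ ≠ e := by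
      rintro rfl
      omega
    refine ⟨_, h4, ?_⟩
    have h6 := hag (e₀ + 1) (by omega)
    rwa [Function.iterate_succ_apply', Function.iterate_succ_apply', ← hag e₀ h3] at h6
  constructor
  · obtain ⟨r, hr, hs⟩ := aux (3 * k) (by omega) hk (by omega)
    have e1 : r.1 % 3 = 0 := by omega
    have e2 : r.1 / 3 = k := by omega
    by_cases c1 : d.1 < v k <;> by_cases c2 : d'.1 < v k <;>
      simp [step, branch, choice, e1, e2, c1, c2] at hs ⊢
  · obtain ⟨r, hr, hs⟩ := aux (3 * k + 2) (by omega) (by omega) (by omega)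
    have e1 : r.1 % 3 = 2 := by omega
    have e2 : r.1 / 3 = k := by omega
    by_cases c1 : d.2 < v k <;> by_cases c2 : d'.2 < v k <;>
      simp [step, branch, choice, e1, e2, c1, c2, Prod.ext_iff] at hs ⊢

theorem step_add (i : ℕ) (z w : ℕ × ℕ) :
    step A v d (i, z + w) = ((step A v d (i, z)).1, (step A v d (i, z)).2 + w) := by
  unfold step branch choice
  split_ifs <;> simp [Prod.ext_iff] <;> omega

theorem iterate_add (e i : ℕ) (z w : ℕ × ℕ) :
    (step A v d)^[e] (i, z + w) =
      (((step A v d)^[e] (i, z)).1, ((step A v d)^[e] (i, z)).2 + w) := by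
  induction e with
  | zero => rfl
  | succ e ih => rw [Function.iterate_succ_apply', Function.iterate_succ_apply', ih, step_add]

/-- Critical paths of the same direction with distinct starting points are disjoint. -/
theorem eq_of_iterate_eq {e e' : ℕ} {z w : ℕ × ℕ}
    (h : (step A v d)^[e] (0, z) = (step A v d)^[e'] (0, w)) : z = w := by
  have mono : StrictMono fun e => ((step A v d)^[e] (0, 0)).1 := by
    refine strictMono_nat_of_lt_succ fun e => ?_
    rw [Function.iterate_succ_apply']
    exact (fst_branch _ _).1
  rw [← zero_add z, ← zero_add w, iterate_add, iterate_add, Prod.mk.injEq] at h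
  obtain rfl := mono.injective h.1
  exact add_left_cancel h.2

theorem iterate_le (hv : ∀ k, v k < A) (e : ℕ) (p : ℕ × ℕ × ℕ) :
    ((step A v d)^[e] p).2.1 + 2 * A * p.1 ≤ p.2.1 + 2 * A * ((step A v d)^[e] p).1 ∧
    ((step A v d)^[e] p).2.2 + p.1 ≤ p.2.2 + ((step A v d)^[e] p).1 := by
  induction e with
  | zero => simp
  | succ e ih =>
    rw [Function.iterate_succ_apply']
    generalize (step A v d)^[e] p = r at ih ⊢
    have hk := hv (r.1 / 3)
    unfold step branch
    split_ifs <;> simp [mul_add] <;> omega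

theorem card_le_of_pairwise_lt_add {S : Finset ℕ} {g : ℕ}
    (h : ∀ a ∈ S, ∀ b ∈ S, b < a + g) : S.card ≤ g := by
  obtain rfl | hS := S.eq_empty_or_nonempty
  · simp
  · have : S ⊆ Finset.Ico (S.min' hS) (S.min' hS + g) := fun b hb =>
      Finset.mem_Ico.mpr ⟨S.min'_le b hb, h _ (S.min'_mem hS) b hb⟩
    simpa using Finset.card_le_card this

theorem lt_add_of_threshold {q s a b k₀ l : ℕ} (hs : s ≤ q) (hl : 2 ^ s ≤ l) (hb : b < 2 ^ q)
    (h : ∀ k, k₀ ≤ k → k < k₀ + l → (a < bitReversal q k ↔ b < bitReversal q k)) :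
    b < a + 2 * 2 ^ (q - s) := by
  by_contra! hab
  have hg : 0 < 2 ^ (q - s) := by positivity
  have e3 : 2 ^ s * 2 ^ (q - s) = 2 ^ q := by rw [← pow_add]; congr 1; omega
  have h1 := Nat.div_add_mod a (2 ^ (q - s))
  have h2 := Nat.mod_lt a hg
  have h3 : (a / 2 ^ (q - s) + 1) * 2 ^ (q - s) =
      2 ^ (q - s) * (a / 2 ^ (q - s)) + 2 ^ (q - s) := by ring
  have ht : a / 2 ^ (q - s) + 1 < 2 ^ s := by
    refine lt_of_mul_lt_mul_right ?_ hg.le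
    rw [e3, h3]
    omega
  obtain ⟨k, h4, h5, h6, h7⟩ := exists_bitReversal_mem_block hs k₀ ht
  rw [add_mul _ 1, one_mul] at h7
  have := h k h4 (by omega)
  omega

theorem card_mul_sub_le {q r : ℕ} {u w : ℕ × ℕ × ℕ} {S : Finset (ℕ × ℕ)}
    (hS : ∀ d ∈ S, d.1 < 2 ^ q ∧ d.2 < 2 ^ q ∧
      ∃ e, (step (2 ^ q) (bitReversal q) d)^[e] u = w)
    (hgap : u.1 + (3 * 2 ^ r + 4) ≤ w.1) (hw : w.1 ≤ 3 * 2 ^ (2 * q - r)) :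
    S.card * (w.1 - u.1) ≤ 56 * 2 ^ (2 * q - r) := by
  obtain ⟨k₀, hk₀⟩ : ∃ k₀, k₀ = (u.1 + 2) / 3 := ⟨_, rfl⟩
  obtain ⟨l, hl⟩ : ∃ l, l = w.1 / 3 - k₀ := ⟨_, rfl⟩
  have hr1 : 1 ≤ 2 ^ r := Nat.one_le_two_pow
  have hrl : 2 ^ r ≤ l := by omega
  have hl0 : l ≠ 0 := by omega
  have hl7 : w.1 - u.1 ≤ 7 * l := by omega
  have hlT : l ≤ 2 ^ (2 * q - r) := by omega
  have main : ∀ s ≤ q, 2 ^ s ≤ l →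
      S.card * (w.1 - u.1) ≤ 28 * (2 ^ (q - s) * 2 ^ (q - s) * l) := by
    intro s hs hsl
    have thr : ∀ d ∈ S, ∀ d' ∈ S, ∀ k, k₀ ≤ k → k < k₀ + l →
        (d.1 < bitReversal q k ↔ d'.1 < bitReversal q k) ∧
        (d.2 < bitReversal q k ↔ d'.2 < bitReversal q k) := by
      intro d hd d' hd' k hk hk'
      obtain ⟨-, h2, e, he⟩ := hS d hd
      obtain ⟨-, h2', e', he'⟩ := hS d' hd'
      exact lt_iff_lt_of_iterate_eq (bitReversal_lt q) h2 h2' (he.trans he'.symm) (by omega)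
        (by rw [he]; omega)
    have c1 : (S.image Prod.fst).card ≤ 2 * 2 ^ (q - s) := by
      refine card_le_of_pairwise_lt_add fun a ha b hb => ?_
      obtain ⟨d, hd, rfl⟩ := Finset.mem_image.mp ha
      obtain ⟨d', hd', rfl⟩ := Finset.mem_image.mp hb
      exact lt_add_of_threshold hs hsl (hS d' hd').1 fun k hk hk' => (thr d hd d' hd' k hk hk').1
    have c2 : (S.image Prod.snd).card ≤ 2 * 2 ^ (q - s) := by
      refine card_le_of_pairwise_lt_add fun a ha b hb => ?_
      obtain ⟨d, hd, rfl⟩ := Finset.mem_image.mp ha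
      obtain ⟨d', hd', rfl⟩ := Finset.mem_image.mp hb
      exact lt_add_of_threshold hs hsl (hS d' hd').2.1 fun k hk hk' => (thr d hd d' hd' k hk hk').2
    calc S.card * (w.1 - u.1)
        ≤ ((2 * 2 ^ (q - s)) * (2 * 2 ^ (q - s))) * (7 * l) := by
          refine Nat.mul_le_mul ?_ hl7
          refine (Finset.card_le_card Finset.subset_product).trans ?_
          rw [Finset.card_product]
          exact Nat.mul_le_mul c1 c2
      _ = 28 * (2 ^ (q - s) * 2 ^ (q - s) * l) := by ring
  by_cases hq : q ≤ Nat.log 2 l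
  · have := main q le_rfl ((Nat.pow_le_pow_right two_pos hq).trans (Nat.pow_log_le_self 2 hl0))
    simp at this
    omega
  · have h1 : l < 2 ^ (Nat.log 2 l + 1) := Nat.lt_pow_succ_log_self one_lt_two l
    have h2 : r ≤ Nat.log 2 l := by
      by_contra! h
      exact absurd (Nat.pow_le_pow_right two_pos h) (by omega)
    refine (main _ (by omega) (Nat.pow_log_le_self 2 hl0)).trans ?_
    generalize Nat.log 2 l = s at *
    calc 28 * (2 ^ (q - s) * 2 ^ (q - s) * l)
        ≤ 28 * (2 ^ (q - s) * 2 ^ (q - s) * 2 ^ (s + 1)) := by gcongr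
      _ = 56 * 2 ^ (2 * q - s) := by
          rw [pow_succ, show 2 * q - s = (q - s) + (q - s) + s by omega, pow_add, pow_add]
          ring
      _ ≤ 56 * 2 ^ (2 * q - r) := by gcongr; omega

end HopsetGraph

section ListLemmas

variable {V : Type} {s t : V} {l : List V}

theorem rel_of_mem_zip_tail {R : V → V → Prop} (h : l.Chain' R) :
    ∀ p ∈ l.zip l.tail, R p.1 p.2 := by
  unfold List.Chain' at h
  induction l with
  | nil => simp
  | cons a l ih =>
    cases l with
    | nil => simp
    | cons b l =>
      rw [List.isChain_cons_cons] at h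
      rintro p hp
      obtain rfl | hp := List.mem_cons.mp hp
      · exact h.1
      · exact ih h.2 p hp

theorem sum_zip_tail_sub (f : V → ℝ) (hs : l.head? = some s) (ht : l.getLast? = some t) :
    ((l.zip l.tail).map fun p => f p.2 - f p.1).sum = f t - f s := by
  induction l generalizing s with
  | nil => simp at hs
  | cons a l ih =>
    obtain rfl : a = s := by simpa using hs
    cases l with
    | nil =>
      obtain rfl : a = t := by simpa using ht
      simp
    | cons b l =>
      have := ih (s := b) (by simp) (by simpa using ht)
      simp only [List.tail_cons, List.zip_cons_cons, List.map_cons, List.sum_cons] at this ⊢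
      rw [this]
      ring

/-- A list whose values go from at most `c` to more than `c` has a step crossing `c`. -/
theorem exists_mem_zip_tail_crossing (f : V → ℕ) {c : ℕ} (hs : l.head? = some s)
    (ht : l.getLast? = some t) (hcs : f s ≤ c) (hct : c < f t) :
    ∃ p ∈ l.zip l.tail, f p.1 ≤ c ∧ c < f p.2 := by
  induction l generalizing s with
  | nil => simp at hs
  | cons a l ih =>
    obtain rfl : a = s := by simpa using hs
    cases l with
    | nil =>
      obtain rfl : a = t := by simpa using ht
      omega
    | cons b l =>
      by_cases hb : f b ≤ c
      · obtain ⟨p, hp, h⟩ := ih (s := b) (by simp) (by simpa using ht) hb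
        exact ⟨p, List.mem_cons_of_mem _ hp, h⟩
      · exact ⟨(a, b), List.mem_cons_self, hcs, not_le.mp hb⟩

theorem fst_of_mem_zip_tail {P : V → Prop} (hs : l.head? = some s) (h : P s)
    (hstep : ∀ p ∈ l.zip l.tail, P p.1 → P p.2) : ∀ p ∈ l.zip l.tail, P p.1 := by
  induction l generalizing s with
  | nil => simp
  | cons a l ih =>
    obtain rfl : a = s := by simpa using hs
    cases l with
    | nil => simp
    | cons b l =>
      intro p hp
      obtain rfl | hp := List.mem_cons.mp hp
      · exact h
      · exact ih (s := b) (by simp) (hstep (a, b) List.mem_cons_self h)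
          (fun p hp => hstep p (List.mem_cons_of_mem _ hp)) p hp

/-- If the total weight of a list is at most the increase of a potential that bounds the weights
from below, then every step is tight. -/
theorem eq_of_sum_zip_tail_le (f : V → ℝ) (w : V × V → ℝ) (hs : l.head? = some s)
    (ht : l.getLast? = some t) (h : ∀ p ∈ l.zip l.tail, f p.2 - f p.1 ≤ w p)
    (hle : ((l.zip l.tail).map w).sum ≤ f t - f s) :
    ∀ p ∈ l.zip l.tail, w p = f p.2 - f p.1 := by
  rw [← sum_zip_tail_sub f hs ht] at hle
  intro p hp
  by_contra hne
  exact absurd (List.sum_lt_sum _ _ h ⟨p, hp, lt_of_le_of_ne (h p hp) (Ne.symm hne)⟩) hle.not_gt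

end ListLemmas

namespace WGraph

variable {V : Type} {G : WGraph V} {s t : V} {l : List V}

theorem walkWeight_eq_length (hG : G.Unweighted) (hl : G.IsWalk s t l) :
    G.walkWeight l = ((l.zip l.tail).length : ℝ) := by
  have : ∀ p ∈ l.zip l.tail, G.w s(p.1, p.2) = 1 := fun p hp =>
    hG _ (rel_of_mem_zip_tail hl.1 p hp)
  rw [walkWeight, List.map_congr_left this]
  simp

theorem exists_isWalk_walkWeight_eq_dist (hG : G.Unweighted) (h : G.Reachable s t) :
    ∃ l, G.IsWalk s t l ∧ G.walkWeight l = G.dist s t ∧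
      ∀ l', G.IsWalk s t l' → G.dist s t ≤ G.walkWeight l' := by
  classical
  have hex : ∃ k, ∃ l, G.IsWalk s t l ∧ (l.zip l.tail).length = k := by
    obtain ⟨l, hl⟩ := h
    exact ⟨_, l, hl, rfl⟩
  obtain ⟨l, hl, hk⟩ := Nat.find_spec hex
  have hmin : ∀ l', G.IsWalk s t l' → G.walkWeight l ≤ G.walkWeight l' := by
    intro l' hl'
    rw [walkWeight_eq_length hG hl, walkWeight_eq_length hG hl', hk]
    exact_mod_cast Nat.find_min' hex ⟨l', hl', rfl⟩
  have : G.dist s t = G.walkWeight l := by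
    refine IsLeast.csInf_eq ⟨⟨l, hl, rfl⟩, ?_⟩
    rintro _ ⟨l', hl', rfl⟩
    exact hmin l' hl'
  exact ⟨l, hl, this.symm, fun l' hl' => this ▸ hmin l' hl'⟩

end WGraph

namespace HopsetGraph

/-- The graph on `Fin n` whose vertices are identified with points by `pos`, and whose edges
are the pairs of a point and one of its two branches. -/
def graph (A : ℕ) (v : ℕ → ℕ) {n : ℕ} (pos : Fin n → ℕ × ℕ × ℕ) : WGraph (Fin n) where
  Edge := ({p | ∃ b, pos p.2 = branch A v b (pos p.1)} : Finset (Fin n × Fin n)).image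
    fun p => s(p.1, p.2)
  w _ := 1

variable {n : ℕ} {pos : Fin n → ℕ × ℕ × ℕ}

theorem graph_unweighted : (graph A v pos).Unweighted := fun _ _ => rfl

theorem mem_graph_edge {a b : Fin n} : s(a, b) ∈ (graph A v pos).Edge ↔
    (∃ c, pos b = branch A v c (pos a)) ∨ ∃ c, pos a = branch A v c (pos b) := by
  simp only [graph, Finset.mem_image, Finset.mem_filter, Finset.mem_univ, true_and, Prod.exists,
    Sym2.eq_iff]
  constructor
  · rintro ⟨a', b', h, ⟨rfl, rfl⟩ | ⟨rfl, rfl⟩⟩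
    · exact Or.inl h
    · exact Or.inr h
  · rintro (h | h)
    · exact ⟨a, b, h, by simp⟩
    · exact ⟨b, a, h, by simp⟩

theorem card_graph_edge_le (hpos : pos.Injective) : (graph A v pos).Edge.card ≤ 2 * n := by
  have key : ∀ b, (Finset.univ.filter fun p : Fin n × Fin n =>
      pos p.2 = branch A v b (pos p.1)).card ≤ n := by
    intro b
    refine (Finset.card_le_card_of_injOn (t := Finset.univ) Prod.fst
      (fun _ _ => Finset.mem_univ _) ?_).trans (by simp)
    intro p hp p' hp' h
    simp only [Finset.coe_filter, Finset.mem_univ, true_and, Set.mem_ofPred_eq] at hp hp'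
    exact Prod.ext h (hpos (by rw [hp, hp', h]))
  refine Finset.card_image_le.trans ?_
  have : (Finset.univ.filter fun p : Fin n × Fin n => ∃ b, pos p.2 = branch A v b (pos p.1)) =
      (Finset.univ.filter fun p : Fin n × Fin n => pos p.2 = branch A v true (pos p.1)) ∪
      (Finset.univ.filter fun p : Fin n × Fin n => pos p.2 = branch A v false (pos p.1)) := by
    ext p
    simp [or_comm]
  rw [this]
  have := key true
  have := key false
  exact (Finset.card_union_le _ _).trans (by omega)

/-- The potential of direction `d`, normalised so that it grows by `1` along critical edges. -/
noncomputable def height (A : ℕ) (v : ℕ → ℕ) (d : ℕ × ℕ) (pos : Fin n → ℕ × ℕ × ℕ) (u : Fin n) :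
    ℝ :=
  potential A v d (pos u) / scale A d

theorem height_edge (hv : ∀ k, v k < A) (h2 : d.2 < A) {a b : Fin n}
    (h : s(a, b) ∈ (graph A v pos).Edge) :
    height A v d pos b - height A v d pos a ≤ 1 ∧
    (height A v d pos b - height A v d pos a = 1 → pos b = step A v d (pos a)) := by
  have hs : (0 : ℝ) < scale A d := by exact_mod_cast scale_pos
  unfold height
  rw [← sub_div, div_le_one hs, div_eq_one_iff_eq hs.ne']
  norm_cast
  obtain ⟨c, h⟩ | ⟨c, h⟩ := mem_graph_edge.mp h
  · have := potential_branch hv h2 c (pos a)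
    rw [h]
    exact ⟨this.1, this.2.2⟩
  · have := potential_branch hv h2 c (pos b)
    rw [← h] at this
    exact ⟨this.2.1.le, fun h => absurd h this.2.1.ne⟩

theorem height_iterate {a b : Fin n} {e : ℕ} (h : pos b = (step A v d)^[e] (pos a)) :
    height A v d pos b - height A v d pos a = e := by
  have hs : (0 : ℝ) < scale A d := by exact_mod_cast scale_pos
  unfold height
  rw [← sub_div, div_eq_iff hs.ne', h, potential_iterate]
  push_cast
  ring

theorem height_sub_le_walkWeight (hv : ∀ k, v k < A) (h2 : d.2 < A) {a b : Fin n}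
    {l : List (Fin n)} (hl : (graph A v pos).IsWalk a b l) :
    height A v d pos b - height A v d pos a ≤ (graph A v pos).walkWeight l := by
  rw [← sum_zip_tail_sub (height A v d pos) hl.2.1 hl.2.2]
  exact List.sum_le_sum fun p hp => (height_edge hv h2 (rel_of_mem_zip_tail hl.1 p hp)).1

theorem height_sub_le_dist (hv : ∀ k, v k < A) (h2 : d.2 < A) {a b : Fin n}
    (h : (graph A v pos).Reachable a b) :
    height A v d pos b - height A v d pos a ≤ (graph A v pos).dist a b := by
  obtain ⟨l, hl, hd, -⟩ := WGraph.exists_isWalk_walkWeight_eq_dist graph_unweighted h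
  rw [← hd]
  exact height_sub_le_walkWeight hv h2 hl

/-- Geodesics that are tight for the potential of direction `d` follow a critical path. -/
theorem exists_iterate_of_dist_eq (hv : ∀ k, v k < A) (h2 : d.2 < A) {a b : Fin n}
    (h : (graph A v pos).Reachable a b)
    (hd : (graph A v pos).dist a b = height A v d pos b - height A v d pos a) :
    ∃ e, pos b = (step A v d)^[e] (pos a) := by
  obtain ⟨l, hl, hw, -⟩ := WGraph.exists_isWalk_walkWeight_eq_dist graph_unweighted h
  have htight := eq_of_sum_zip_tail_le (height A v d pos) (fun _ => 1) hl.2.1 hl.2.2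
    (fun p hp => (height_edge hv h2 (rel_of_mem_zip_tail hl.1 p hp)).1) (hw.trans hd).le
  have hstep : ∀ p ∈ l.zip l.tail, pos p.2 = step A v d (pos p.1) := fun p hp =>
    (height_edge hv h2 (rel_of_mem_zip_tail hl.1 p hp)).2 (htight p hp).symm
  obtain ⟨-, hs, ht⟩ := hl
  clear h hd hw htight
  induction l generalizing a with
  | nil => simp at hs
  | cons a' l ih =>
    obtain rfl : a' = a := by simpa using hs
    cases l with
    | nil =>
      obtain rfl : a' = b := by simpa using ht
      exact ⟨0, rfl⟩
    | cons c l =>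
      obtain ⟨e, he⟩ := ih (a := c) (fun p hp => hstep p (List.mem_cons_of_mem _ hp)) (by simp)
        (by simpa using ht)
      refine ⟨e + 1, ?_⟩
      rw [Function.iterate_succ_apply, ← hstep (a', c) List.mem_cons_self, he]

theorem exists_isWalk_of_iterate (hbox : IsLowerSet (Set.range pos)) {a b : Fin n} {e : ℕ}
    (h : pos b = (step A v d)^[e] (pos a)) (hpos : pos.Injective) :
    ∃ l, (graph A v pos).IsWalk a b l ∧ (l.zip l.tail).length = e := by
  induction e generalizing a with
  | zero =>
    obtain rfl : b = a := hpos h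
    exact ⟨[b], ⟨by simp [List.Chain'], by simp, by simp⟩, by simp⟩
  | succ e ih =>
    rw [Function.iterate_succ_apply] at h
    obtain ⟨c, hc⟩ : step A v d (pos a) ∈ Set.range pos :=
      hbox (h ▸ le_iterate e _) ⟨b, rfl⟩
    rw [← hc] at h
    obtain ⟨l, ⟨h1, h2, h3⟩, h4⟩ := ih h
    cases l with
    | nil => simp at h2
    | cons c' l =>
      obtain rfl : c' = c := by simpa using h2
      refine ⟨a :: c' :: l, ⟨?_, by simp, by simpa using h3⟩, by simpa using h4⟩
      exact List.isChain_cons_cons.mpr ⟨mem_graph_edge.mpr (Or.inl ⟨_, hc⟩), h1⟩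

theorem reachable_and_dist_eq (hv : ∀ k, v k < A) (h2 : d.2 < A)
    (hbox : IsLowerSet (Set.range pos)) (hpos : pos.Injective) {a b : Fin n} {e : ℕ}
    (h : pos b = (step A v d)^[e] (pos a)) :
    (graph A v pos).Reachable a b ∧
      (graph A v pos).dist a b = height A v d pos b - height A v d pos a := by
  obtain ⟨l, hl, hle⟩ := exists_isWalk_of_iterate hbox h hpos
  have hr : (graph A v pos).Reachable a b := ⟨l, hl⟩
  refine ⟨hr, le_antisymm ?_ (height_sub_le_dist hv h2 hr)⟩
  obtain ⟨-, -, -, hmin⟩ := WGraph.exists_isWalk_walkWeight_eq_dist graph_unweighted hr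
  rw [height_iterate h, ← hle, ← WGraph.walkWeight_eq_length graph_unweighted hl]
  exact hmin l hl

/-- A geodesic of `G ∪ H` between two points of a critical path visits points of this critical
path only. -/
theorem hopWalk_steps (hv : ∀ k, v k < A) (h2 : d.2 < A) (hbox : IsLowerSet (Set.range pos))
    (hpos : pos.Injective) {H : Finset (Sym2 (Fin n))}
    (hH : ∀ a b : Fin n, s(a, b) ∈ H → (graph A v pos).Reachable a b) {a b : Fin n} {e : ℕ}
    (h : pos b = (step A v d)^[e] (pos a)) {l : List (Fin n)}
    (hl : l.Chain' fun a b => s(a, b) ∈ (graph A v pos).Edge ∪ H) (hs : l.head? = some a)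
    (ht : l.getLast? = some b)
    (hw : hopWalkWeight (graph A v pos) H l = (graph A v pos).dist a b) :
    ∀ p ∈ l.zip l.tail, (∃ e, pos p.2 = (step A v d)^[e] (pos p.1)) ∧
      (s(p.1, p.2) ∈ H ∨ (pos p.2).1 ≤ (pos p.1).1 + 2) := by
  have hmem := rel_of_mem_zip_tail hl
  rw [(reachable_and_dist_eq hv h2 hbox hpos h).2] at hw
  have htight := eq_of_sum_zip_tail_le (height A v d pos)
    (fun p => if s(p.1, p.2) ∈ (graph A v pos).Edge then (graph A v pos).w s(p.1, p.2)
      else (graph A v pos).dist p.1 p.2) hs ht ?_ hw.le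
  · intro p hp
    have h3 := htight p hp
    by_cases hE : s(p.1, p.2) ∈ (graph A v pos).Edge
    · rw [if_pos hE, graph_unweighted _ hE] at h3
      have h4 := (height_edge hv h2 hE).2 h3.symm
      refine ⟨⟨1, h4⟩, Or.inr ?_⟩
      rw [h4]
      exact (fst_branch _ _).2
    · rw [if_neg hE] at h3
      have h4 : s(p.1, p.2) ∈ H := (Finset.mem_union.mp (hmem p hp)).resolve_left hE
      exact ⟨exists_iterate_of_dist_eq hv h2 (hH _ _ h4) h3, Or.inl h4⟩
  · intro p hp
    by_cases hE : s(p.1, p.2) ∈ (graph A v pos).Edge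
    · rw [if_pos hE, graph_unweighted _ hE]
      exact (height_edge hv h2 hE).1
    · rw [if_neg hE]
      exact height_sub_le_dist hv h2
        (hH _ _ ((Finset.mem_union.mp (hmem p hp)).resolve_left hE))

theorem three_mul_le_two_mul_sum_gap {T g : ℕ} {l : List (Fin n)} {a b : Fin n}
    (hs : l.head? = some a) (ht : l.getLast? = some b) (ha : (pos a).1 = 0)
    (hb : (pos b).1 = 3 * T) (hl : (l.length - 1) * g ≤ T) {S : Finset (Fin n × Fin n)}
    (hS : ∀ p ∈ l.zip l.tail, (pos p.1).1 + g ≤ (pos p.2).1 → p ∈ S) :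
    3 * T ≤ 2 * ∑ p ∈ S, ((pos p.2).1 - (pos p.1).1) := by
  obtain ⟨Z, hZ⟩ : ∃ Z, Z = (l.zip l.tail).toFinset := ⟨_, rfl⟩
  have hcard : Z.card ≤ l.length - 1 := by
    rw [hZ]
    refine (List.toFinset_card_le _).trans ?_
    simp
  have hcover : Finset.range (3 * T) ⊆ Z.biUnion fun p => Finset.Ico (pos p.1).1 (pos p.2).1 := by
    intro c hc
    rw [Finset.mem_range] at hc
    obtain ⟨p, hp, h1, h2⟩ := exists_mem_zip_tail_crossing (fun u => (pos u).1) hs ht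
      (c := c) (by simp [ha]) (by simpa [hb] using hc)
    exact Finset.mem_biUnion.mpr ⟨p, by simpa [hZ] using hp, Finset.mem_Ico.mpr ⟨h1, h2⟩⟩
  have h1 : 3 * T ≤ ∑ p ∈ Z, ((pos p.2).1 - (pos p.1).1) := by
    simpa using (Finset.card_le_card hcover).trans Finset.card_biUnion_le
  rw [← Finset.sum_filter_add_sum_filter_not Z fun p => (pos p.1).1 + g ≤ (pos p.2).1] at h1
  have h2 : ∑ p ∈ Z with (pos p.1).1 + g ≤ (pos p.2).1, ((pos p.2).1 - (pos p.1).1) ≤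
      ∑ p ∈ S, ((pos p.2).1 - (pos p.1).1) := by
    refine Finset.sum_le_sum_of_subset fun p hp => ?_
    rw [Finset.mem_filter, hZ, List.mem_toFinset] at hp
    exact hS p hp.1 hp.2
  have h3 : ∑ p ∈ Z with ¬ (pos p.1).1 + g ≤ (pos p.2).1, ((pos p.2).1 - (pos p.1).1) ≤ T := by
    refine (Finset.sum_le_card_nsmul _ _ g ?_).trans ?_
    · intro p hp
      have := (Finset.mem_filter.mp hp).2
      omega
    · rw [smul_eq_mul]
      exact (Nat.mul_le_mul_right _ ((Finset.card_filter_le _ _).trans hcard)).trans hl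
  omega

/-- If `G ∪ H` has geodesics with few edges between all pairs, then `H` is large. -/
theorem card_paths_le {q r A T : ℕ} (hA : A = 2 ^ q) (hT : T = 2 ^ (2 * q - r))
    (hpos : pos.Injective)
    (hrange : ∀ p : ℕ × ℕ × ℕ, p ∈ Set.range pos ↔
      p.1 ≤ 3 * T ∧ p.2.1 < 12 * A * T ∧ p.2.2 < 6 * T)
    {H : Finset (Sym2 (Fin n))}
    (hH : ∀ a b : Fin n, s(a, b) ∈ H → (graph A (bitReversal q) pos).Reachable a b)
    (hwalk : ∀ a b : Fin n, (graph A (bitReversal q) pos).Reachable a b →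
      ∃ l : List (Fin n),
        (l.Chain' fun a b => s(a, b) ∈ (graph A (bitReversal q) pos).Edge ∪ H) ∧
        l.head? = some a ∧ l.getLast? = some b ∧
        hopWalkWeight (graph A (bitReversal q) pos) H l =
          (graph A (bitReversal q) pos).dist a b ∧
        (l.length - 1) * (3 * 2 ^ r + 4) ≤ T) :
    54 * A ^ 3 * T ^ 2 ≤ 112 * H.card := by
  classical
  have hv : ∀ k, bitReversal q k < A := fun k => hA ▸ bitReversal_lt q k
  have hT0 : 0 < T := by rw [hT]; positivity
  have hcount := @card_mul_sub_le q r
  rw [← hT, ← hA] at hcount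
  have hbox : IsLowerSet (Set.range pos) := by
    intro p p' hle hp
    rw [hrange] at hp ⊢
    exact ⟨hle.1.trans hp.1, hle.2.1.trans_lt hp.2.1, hle.2.2.trans_lt hp.2.2⟩
  let cov : (ℕ × ℕ) × ℕ × ℕ → Fin n × Fin n → Prop := fun π p =>
    (∃ e, pos p.1 = (step A (bitReversal q) π.2)^[e] (0, π.1)) ∧
      ∃ e, pos p.2 = (step A (bitReversal q) π.2)^[e] (pos p.1)
  let paths : Finset ((ℕ × ℕ) × ℕ × ℕ) :=
    (Finset.range (6 * A * T) ×ˢ Finset.range (3 * T)) ×ˢ (Finset.range A ×ˢ Finset.range A)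
  let long : Finset (Fin n × Fin n) :=
    {p | s(p.1, p.2) ∈ H ∧ (pos p.1).1 + (3 * 2 ^ r + 4) ≤ (pos p.2).1}
  have hlong : long.card ≤ H.card := by
    refine Finset.card_le_card_of_injOn (fun p => s(p.1, p.2)) ?_ ?_
    · intro p hp
      simp only [long, Finset.coe_filter, Finset.mem_univ, true_and, Set.mem_ofPred_eq] at hp
      exact hp.1
    · intro p hp p' hp' h
      simp only [long, Finset.coe_filter, Finset.mem_univ, true_and, Set.mem_ofPred_eq] at hp hp'
      obtain ⟨h1, h2⟩ | ⟨h1, h2⟩ := Sym2.eq_iff.mp h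
      · exact Prod.ext h1 h2
      · rw [h1, h2] at hp
        omega
  have hpath : ∀ π ∈ paths, 3 * T ≤ 2 * ∑ p ∈ long with cov π p, ((pos p.2).1 - (pos p.1).1) := by
    rintro ⟨⟨x, y⟩, d⟩ hπ
    simp only [paths, Finset.mem_product, Finset.mem_range] at hπ
    obtain ⟨⟨hx, hy⟩, hd1, hd2⟩ := hπ
    obtain ⟨a, ha⟩ : ((0, x, y) : ℕ × ℕ × ℕ) ∈ Set.range pos := by
      rw [hrange]
      refine ⟨by simp, ?_, ?_⟩ <;> simp only <;> nlinarith
    obtain ⟨e, -, he⟩ := exists_fst_iterate_eq (A := A) (v := bitReversal q) (d := d)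
      (i := 3 * T) (by omega) (p := (0, x, y)) (by simp) (e := 3 * T)
      (by simpa using add_le_fst_iterate (A := A) (v := bitReversal q) (d := d) (3 * T) (0, x, y))
    obtain ⟨b, hb⟩ : (step A (bitReversal q) d)^[e] (0, x, y) ∈ Set.range pos := by
      obtain ⟨h1, h2⟩ := iterate_le (d := d) hv e (0, x, y)
      rw [he] at h1 h2
      simp only at h1 h2
      rw [hrange]
      refine ⟨he.le, ?_, ?_⟩ <;> nlinarith
    have hab : pos b = (step A (bitReversal q) d)^[e] (pos a) := by rw [hb, ha]
    obtain ⟨l, hl, hs, ht, hw, hlen⟩ :=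
      hwalk a b (reachable_and_dist_eq hv hd2 hbox hpos hab).1
    have hsteps := hopWalk_steps hv hd2 hbox hpos hH hab hl hs ht hw
    have hon := fst_of_mem_zip_tail
      (P := fun u => ∃ e, pos u = (step A (bitReversal q) d)^[e] (0, x, y)) hs ⟨0, ha⟩ (by
        rintro p hp ⟨e, he⟩
        obtain ⟨⟨e', he'⟩, -⟩ := hsteps p hp
        exact ⟨e' + e, by rw [he', he, Function.iterate_add_apply]⟩)
    refine three_mul_le_two_mul_sum_gap hs ht (by rw [ha]) (by rw [hb, he]) hlen ?_
    intro p hp hgap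
    obtain ⟨h1, h2⟩ := hsteps p hp
    simp only [long, Finset.mem_filter, Finset.mem_univ, true_and]
    exact ⟨⟨h2.resolve_right (by omega), hgap⟩, hon p hp, h1⟩
  have hedge : ∀ p ∈ long, ∑ π ∈ paths with cov π p, ((pos p.2).1 - (pos p.1).1) ≤ 56 * T := by
    intro p hp
    simp only [long, Finset.mem_filter, Finset.mem_univ, true_and] at hp
    rw [Finset.sum_const, smul_eq_mul]
    have hinj : Set.InjOn Prod.snd (paths.filter fun π => cov π p : Set ((ℕ × ℕ) × ℕ × ℕ)) := by
      rintro ⟨z, d⟩ hπ ⟨z', d'⟩ hπ' h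
      obtain rfl : d = d' := h
      simp only [Finset.coe_filter, Set.mem_ofPred_eq] at hπ hπ'
      obtain ⟨-, ⟨e, he⟩, -⟩ := hπ
      obtain ⟨-, ⟨e', he'⟩, -⟩ := hπ'
      exact Prod.ext (eq_of_iterate_eq (he.symm.trans he')) rfl
    rw [← Finset.card_image_of_injOn hinj]
    refine hcount ?_ hp.2 ((hrange _).mp ⟨p.2, rfl⟩).1
    intro d hd
    obtain ⟨π, hπ, rfl⟩ := Finset.mem_image.mp hd
    obtain ⟨h1, -, e, he⟩ := Finset.mem_filter.mp hπ
    simp only [paths, Finset.mem_product, Finset.mem_range] at h1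
    exact ⟨h1.2.1, h1.2.2, e, he.symm⟩
  have htotal : paths.card * (3 * T) ≤ 2 * (long.card * (56 * T)) := by
    calc paths.card * (3 * T)
        ≤ ∑ π ∈ paths, 2 * ∑ p ∈ long with cov π p, ((pos p.2).1 - (pos p.1).1) := by
          rw [← smul_eq_mul]
          exact Finset.card_nsmul_le_sum _ _ _ hpath
      _ = 2 * ∑ p ∈ long, ∑ π ∈ paths with cov π p, ((pos p.2).1 - (pos p.1).1) := by
          rw [← Finset.mul_sum]
          simp only [Finset.sum_filter]
          rw [Finset.sum_comm]
      _ ≤ 2 * (long.card * (56 * T)) := by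
          rw [← smul_eq_mul long.card]
          exact Nat.mul_le_mul_left _ (Finset.sum_le_card_nsmul _ _ _ hedge)
  have hcard : paths.card = 18 * A ^ 3 * T ^ 2 := by
    simp only [paths, Finset.card_product, Finset.card_range]
    ring
  rw [hcard] at htotal
  have h1 : (54 * A ^ 3 * T ^ 2) * T ≤ (112 * long.card) * T := by linarith
  have h2 := Nat.le_of_mul_le_mul_right h1 hT0
  omega

theorem exists_pos {n L X Y : ℕ} (hn : n = (L + 1) * (X * Y)) :
    ∃ pos : Fin n → ℕ × ℕ × ℕ, pos.Injective ∧
      ∀ p, p ∈ Set.range pos ↔ p.1 ≤ L ∧ p.2.1 < X ∧ p.2.2 < Y := by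
  let e : Fin n ≃ Fin (L + 1) × Fin X × Fin Y :=
    Fintype.equivOfCardEq (by simp [hn])
  refine ⟨fun u => ((e u).1, (e u).2.1, (e u).2.2), fun u u' h => e.injective ?_, fun p => ?_⟩
  · simp only [Prod.mk.injEq, Fin.val_inj] at h
    exact Prod.ext h.1 (Prod.ext h.2.1 h.2.2)
  · constructor
    · rintro ⟨u, rfl⟩
      exact ⟨by simpa [Nat.lt_succ_iff] using (e u).1.2, (e u).2.1.2, (e u).2.2.2⟩
    · rintro ⟨h1, h2, h3⟩
      exact ⟨e.symm (⟨p.1, Nat.lt_succ_of_le h1⟩, ⟨p.2.1, h2⟩, ⟨p.2.2, h3⟩), by simp⟩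

theorem rpow_two_sevenths_le {n A T R : ℕ} (hn : n ≤ 288 * A * T ^ 3) (hA : A ^ 2 = R * T) :
    (n : ℝ) ^ ((2 : ℝ) / 7) ≤ 82944 * R * T := by
  have h1 : n ^ 2 ≤ (82944 * R * T) ^ 7 := by
    calc n ^ 2 ≤ (288 * A * T ^ 3) ^ 2 := Nat.pow_le_pow_left hn 2
      _ = 82944 * (R * T) * T ^ 6 := by rw [← hA]; ring
      _ = (82944 * R) * T ^ 7 := by ring
      _ ≤ (82944 * R) ^ 7 * T ^ 7 := Nat.mul_le_mul_right _ (Nat.le_self_pow (by norm_num) _)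
      _ = (82944 * R * T) ^ 7 := by ring
  have h2 : (n : ℝ) ^ 2 ≤ (82944 * R * T : ℝ) ^ 7 := by exact_mod_cast h1
  have h3 := Real.rpow_le_rpow (by positivity) h2 (by positivity : (0 : ℝ) ≤ ((7 : ℕ) : ℝ)⁻¹)
  rw [Real.pow_rpow_inv_natCast (by positivity) (by norm_num), ← Real.rpow_natCast (n : ℝ) 2,
    ← Real.rpow_mul (by positivity)] at h3
  norm_num at h3 ⊢
  exact h3

end HopsetGraph

/-- `Ω(n^{2/7})` hopbound lower bound for `O(m)`-size exact hopsets of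
undirected unweighted graphs. -/
theorem exact_hopset_lower_bound (c : ℝ) (hc : 0 < c) :
    ∃ c' : ℝ, 0 < c' ∧ ∀ N : ℕ, ∃ n : ℕ, N ≤ n ∧
      ∃ G : WGraph (Fin n), G.Unweighted ∧
        ∀ H : Finset (Sym2 (Fin n)), (∀ a b : Fin n, s(a, b) ∈ H → G.Reachable a b) →
          (H.card : ℝ) ≤ c * (G.Edge.card : ℝ) →
          ∃ s t : Fin n, G.Reachable s t ∧
            ∀ l : List (Fin n), (l.Chain' fun a b => s(a, b) ∈ G.Edge ∪ H) →
              l.head? = some s → l.getLast? = some t →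
              hopWalkWeight G H l = G.dist s t →
              c' * (n : ℝ) ^ ((2 : ℝ) / 7) < (l.length : ℝ) - 1 := by
  obtain ⟨r, hr⟩ := pow_unbounded_of_one_lt (1200 * c) (one_lt_two : (1 : ℝ) < 2)
  have hg : (0 : ℝ) < 3 * 2 ^ r + 4 := by positivity
  refine ⟨1 / ((3 * 2 ^ r + 4) * (82944 * 2 ^ r)), by positivity, fun N => ?_⟩
  obtain ⟨q, hq⟩ : ∃ q, q = r + N := ⟨_, rfl⟩
  obtain ⟨T, hT⟩ : ∃ T, T = 2 ^ (2 * q - r) := ⟨_, rfl⟩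
  have hT0 : 0 < T := by rw [hT]; positivity
  have hA : (2 ^ q) ^ 2 = 2 ^ r * T := by
    rw [hT, ← pow_mul, ← pow_add]
    congr 1
    omega
  have hNT : N ≤ T := by
    rw [hT]
    exact Nat.lt_two_pow_self.le.trans (Nat.pow_le_pow_right two_pos (by omega))
  obtain ⟨A, hAq⟩ : ∃ A, A = 2 ^ q := ⟨_, rfl⟩
  rw [← hAq] at hA
  have hA0 : 0 < A := by rw [hAq]; positivity
  obtain ⟨n, hn⟩ : ∃ n, n = (3 * T + 1) * (12 * A * T * (6 * T)) := ⟨_, rfl⟩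
  have hAT : 1 ≤ A * T := Nat.mul_pos hA0 hT0
  have hn_le : n ≤ 288 * A * T ^ 3 := by
    calc n = (3 * T + 1) * (72 * A * T ^ 2) := by rw [hn]; ring
      _ ≤ (4 * T) * (72 * A * T ^ 2) := Nat.mul_le_mul_right _ (by omega)
      _ = 288 * A * T ^ 3 := by ring
  have hNn : N ≤ n := by
    refine hNT.trans ?_
    calc T ≤ (3 * T + 1) * (72 * (A * T) * T) := by nlinarith [Nat.mul_pos hAT hT0]
      _ = n := by rw [hn]; ring
  obtain ⟨pos, hpos, hrange⟩ := HopsetGraph.exists_pos hn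
  refine ⟨n, hNn, HopsetGraph.graph A (bitReversal q) pos, HopsetGraph.graph_unweighted,
    fun H hH hcard => ?_⟩
  by_contra! hshort
  have hroot := HopsetGraph.rpow_two_sevenths_le hn_le hA
  push_cast at hroot
  have hlarge := HopsetGraph.card_paths_le hAq hT hpos hrange hH (fun a b hab => by
    obtain ⟨l, hl, hs, ht, hw, hlen⟩ := hshort a b hab
    refine ⟨l, hl, hs, ht, hw, ?_⟩
    have h1 : ((l.length : ℝ) - 1) * (3 * 2 ^ r + 4) ≤ T := by
      rw [← le_div_iff₀ hg]
      refine hlen.trans ((mul_le_mul_of_nonneg_left hroot (by positivity)).trans_eq ?_)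
      field_simp
    have h2 : 1 ≤ l.length := by
      rcases l with _ | ⟨x, l⟩
      · simp at hs
      · simp
    rw [← Nat.cast_le (α := ℝ)]
    push_cast [Nat.cast_sub h2]
    exact h1)
  have hm := HopsetGraph.card_graph_edge_le (A := A) (v := bitReversal q) (pos := pos) hpos
  have hlarge' : (54 * A ^ 3 * T ^ 2 : ℝ) ≤ 112 * H.card := by exact_mod_cast hlarge
  have hm' : ((HopsetGraph.graph A (bitReversal q) pos).Edge.card : ℝ) ≤ 2 * n := by
    exact_mod_cast hm
  have hn' : (n : ℝ) ≤ 288 * A * T ^ 3 := by exact_mod_cast hn_le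
  have hA' : (A : ℝ) ^ 2 = 2 ^ r * T := by exact_mod_cast hA
  have h1 : (H.card : ℝ) ≤ c * (2 * (288 * A * T ^ 3)) :=
    hcard.trans (mul_le_mul_of_nonneg_left (hm'.trans (by linarith)) hc.le)
  have h2 : (54 * 2 ^ r : ℝ) * (A * T ^ 3) ≤ 64512 * c * (A * T ^ 3) := by
    calc (54 * 2 ^ r : ℝ) * (A * T ^ 3) = (54 : ℝ) * A * (2 ^ r * T : ℝ) * T ^ 2 := by ring
      _ = (54 * A ^ 3 * T ^ 2 : ℝ) := by rw [← hA']; ring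
      _ ≤ (112 : ℝ) * (c * (2 * (288 * A * T ^ 3))) := by linarith
      _ = 64512 * c * (A * T ^ 3) := by ring
  have h3 := le_of_mul_le_mul_right h2 (by positivity)
  linarith
end
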